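/- Let X be a proper CAT(0) space and G a group acting cocompactly by isometries. Suppose a : ℝ → X is an A-contracting bi-infinite geodesic with a(0) = x whose forward endpoint α⁺ = a(∞) is not globally fixed by G, and let b be any geodesic ray with b(0) = x. Then there is a constant E, depending only on A, the slimness constant δ_A, and the cocompactness constant C, and a sequence g_i ∈ G, such that the rays k_i = [x, g_i α⁺) satisfy d(k_i(i), b(i)) ≤ E for all i; consequently k_i → b in the visual boundary ∂X. -/

import Mathlib

open Metric Set Filter

variable {X : Type*} [MetricSpace X]

/-- A metric space is CAT(0) if midpoints exist and satisfy the CN comparison inequality. -/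
def IsCAT0 (X : Type*) [MetricSpace X] : Prop :=
  ∀ x y : X, ∃ m : X, dist x m = dist x y / 2 ∧ dist y m = dist x y / 2 ∧
    ∀ z : X, dist z m ^ 2 ≤ (dist z x ^ 2 + dist z y ^ 2) / 2 - dist x y ^ 2 / 4

/-- A geodesic ray: isometric embedding of `[0, ∞)`. -/
def IsRay (c : ℝ → X) : Prop :=
  ∀ s t : ℝ, 0 ≤ s → 0 ≤ t → dist (c s) (c t) = |s - t|

/-- A bi-infinite geodesic: isometric embedding of `ℝ`. -/
def IsGeodesicLine (c : ℝ → X) : Prop :=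
  ∀ s t : ℝ, dist (c s) (c t) = |s - t|

/-- A geodesic segment from `y` to `z`, parametrized on `[0, dist y z]`. -/
def IsGeodesicSeg (g : ℝ → X) (y z : X) : Prop :=
  g 0 = y ∧ g (dist y z) = z ∧
    ∀ s t, s ∈ Icc 0 (dist y z) → t ∈ Icc 0 (dist y z) → dist (g s) (g t) = |s - t|

/-- `π` is a nearest-point projection onto the set `S`. -/
def IsProjOn (S : Set X) (π : X → X) : Prop :=
  ∀ p : X, π p ∈ S ∧ ∀ q ∈ S, dist p (π p) ≤ dist p q

/-- The set `S` (image of a geodesic) is `A`-contracting. -/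
def ContractingSet (A : ℝ) (S : Set X) : Prop :=
  ∃ π : X → X, IsProjOn S π ∧
    ∀ p q : X, dist p q < dist p (π p) → dist (π p) (π q) < A

/-- Slimness with respect to a given nearest-point projection `π` onto `S`:
every geodesic from `y` to a point `z ∈ S` passes within `δ` of `π y`. -/
def SlimWith (δ : ℝ) (S : Set X) (π : X → X) : Prop :=
  ∀ y z, z ∈ S → ∀ g : ℝ → X, IsGeodesicSeg g y z →
    ∃ s ∈ Icc (0:ℝ) (dist y z), dist (π y) (g s) ≤ δ

/-- The set `S` is `δ`-slim. -/
def SlimSet (δ : ℝ) (S : Set X) : Prop :=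
  ∃ π : X → X, IsProjOn S π ∧ SlimWith δ S π

/-- Two rays are asymptotic (bounded Hausdorff distance). -/
def Asymp (a b : ℝ → X) : Prop :=
  ∃ M : ℝ, ∀ t : ℝ, 0 ≤ t → dist (a t) (b t) ≤ M

/-- `p` lies metrically between `x` and `y`. -/
def MetricBtw (x p y : X) : Prop := dist x p + dist p y = dist x y

theorem MetricBtw.symm {x p y : X} (h : MetricBtw x p y) : MetricBtw y p x := by
  unfold MetricBtw at *
  rw [dist_comm y p, dist_comm p x, dist_comm y x]
  linarith

/-- If `p` lies between `x` and `y` and `q` between `p` and `y`, then `q` lies between `x`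
and `y`. -/
theorem MetricBtw.trans_right {x p q y : X} (h : MetricBtw x p y) (h' : MetricBtw p q y) :
    MetricBtw x q y := by
  unfold MetricBtw at *
  linarith [dist_triangle x p q, dist_triangle x q y]

theorem MetricBtw.trans_left {x p q y : X} (h : MetricBtw x p y) (h' : MetricBtw x q p) :
    MetricBtw x q y :=
  (h.symm.trans_right h'.symm).symm

/-- If `p` lies between `x` and `y` and `q` between `p` and `y`, then `p` lies between `x`
and `q`. -/
theorem MetricBtw.left_of_right {x p q y : X} (h : MetricBtw x p y) (h' : MetricBtw p q y) :
    MetricBtw x p q := by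
  unfold MetricBtw at *
  linarith [dist_triangle x p q, dist_triangle x q y]

theorem MetricBtw.of_dist {x p y : X} {l : ℝ} (h₁ : dist x p = l * dist x y)
    (h₂ : dist p y = (1 - l) * dist x y) : MetricBtw x p y := by
  unfold MetricBtw
  rw [h₁, h₂]
  ring

theorem MetricBtw.exists_ratio {x p y : X} (h : MetricBtw x p y) :
    ∃ l : ℝ, 0 ≤ l ∧ l ≤ 1 ∧ dist x p = l * dist x y ∧ dist p y = (1 - l) * dist x y := by
  unfold MetricBtw at h
  have h₁ : 0 ≤ dist x p := dist_nonneg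
  have h₂ : 0 ≤ dist p y := dist_nonneg
  rcases eq_or_lt_of_le (dist_nonneg : 0 ≤ dist x y) with h0 | h0
  · exact ⟨0, le_rfl, zero_le_one, by linarith, by linarith⟩
  · refine ⟨dist x p / dist x y, by positivity, (div_le_one h0).2 (by linarith), ?_, ?_⟩
    · field_simp
    · field_simp
      linarith

theorem exists_approx_btw (hX : IsCAT0 X) (n : ℕ) : ∀ (x y : X) (r : ℝ), 0 ≤ r →
    r ≤ dist x y → ∃ p, MetricBtw x p y ∧ |dist x p - r| ≤ dist x y / 2 ^ n := by
  induction n with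
  | zero =>
    intro x y r h0 h1
    refine ⟨x, by simp [MetricBtw], ?_⟩
    simpa [abs_of_nonneg h0] using h1
  | succ n ih =>
    intro x y r h0 h1
    obtain ⟨m, hxm, hym, -⟩ := hX x y
    rw [dist_comm] at hym
    have hm : MetricBtw x m y := by unfold MetricBtw; linarith
    have e : dist x y / 2 ^ (n + 1) = dist x y / 2 / 2 ^ n := by rw [pow_succ]; field_simp
    rcases le_total r (dist x y / 2) with h | h
    · obtain ⟨p, hp, hpr⟩ := ih x m r h0 (by linarith)
      refine ⟨p, hm.trans_left hp, ?_⟩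
      rwa [e, ← hxm]
    · obtain ⟨p, hp, hpr⟩ := ih m y (r - dist x y / 2) (by linarith) (by linarith)
      refine ⟨p, hm.trans_right hp, ?_⟩
      have := hm.left_of_right hp
      unfold MetricBtw at this
      rw [e, ← this, hxm]
      rw [hym] at hpr
      convert hpr using 2
      ring

theorem isCompact_btw [ProperSpace X] (x y : X) : IsCompact {p : X | MetricBtw x p y} := by
  refine Metric.isCompact_of_isClosed_isBounded ?_ ?_
  · exact isClosed_eq (by fun_prop) (by fun_prop)
  · refine (Metric.isBounded_closedBall (x := x) (r := dist x y)).subset fun p hp => ?_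
    have hp : dist x p + dist p y = dist x y := hp
    rw [mem_closedBall, dist_comm]
    linarith [dist_nonneg (x := p) (y := y)]

theorem exists_btw_dist_eq [ProperSpace X] (hX : IsCAT0 X) (x y : X) {r : ℝ} (h0 : 0 ≤ r)
    (h1 : r ≤ dist x y) : ∃ p, MetricBtw x p y ∧ dist x p = r := by
  have hcl : IsClosed ((fun p => dist x p) '' {p : X | MetricBtw x p y}) :=
    ((isCompact_btw x y).image (by fun_prop)).isClosed
  have hr : r ∈ closure ((fun p => dist x p) '' {p : X | MetricBtw x p y}) := by
    rw [Metric.mem_closure_iff]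
    intro ε hε
    obtain ⟨n, hn⟩ : ∃ n : ℕ, dist x y / 2 ^ n < ε := by
      have : Tendsto (fun n : ℕ => dist x y * (1 / 2 : ℝ) ^ n) atTop (nhds (dist x y * 0)) :=
        (tendsto_pow_atTop_nhds_zero_of_lt_one (by norm_num) (by norm_num)).const_mul _
      rw [mul_zero] at this
      obtain ⟨n, hn⟩ := (this.eventually_lt_const hε).exists
      refine ⟨n, ?_⟩
      rwa [one_div, inv_pow, ← div_eq_mul_inv] at hn
    obtain ⟨p, hp, hpr⟩ := exists_approx_btw hX n x y r h0 h1
    refine ⟨_, ⟨p, hp, rfl⟩, ?_⟩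
    rw [dist_comm, Real.dist_eq]
    exact hpr.trans_lt hn
  rw [hcl.closure_eq] at hr
  obtain ⟨p, hp, h⟩ := hr
  exact ⟨p, hp, h⟩

theorem exists_ratio_btw [ProperSpace X] (hX : IsCAT0 X) (x y : X) {l : ℝ} (h0 : 0 ≤ l)
    (h1 : l ≤ 1) : ∃ p, dist x p = l * dist x y ∧ dist p y = (1 - l) * dist x y := by
  obtain ⟨p, hp, h⟩ := exists_btw_dist_eq hX x y (r := l * dist x y) (by positivity)
    (mul_le_of_le_one_left dist_nonneg h1)
  refine ⟨p, h, ?_⟩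
  unfold MetricBtw at hp
  linarith

/-- The CN inequality holds for every midpoint. -/
theorem IsCAT0.cn (hX : IsCAT0 X) {x y m : X} (h₁ : dist x m = dist x y / 2)
    (h₂ : dist y m = dist x y / 2) (z : X) :
    dist z m ^ 2 ≤ (dist z x ^ 2 + dist z y ^ 2) / 2 - dist x y ^ 2 / 4 := by
  obtain ⟨m', -, -, h⟩ := hX x y
  have hm := h m
  rw [dist_comm m x, dist_comm m y, h₁, h₂] at hm
  have h0 : dist m m' ^ 2 = 0 := le_antisymm (by linarith) (sq_nonneg _)
  rw [dist_eq_zero.1 (pow_eq_zero_iff (two_ne_zero) |>.1 h0)]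
  exact h z

/-- Stewart's inequality. -/
theorem IsCAT0.stewart [ProperSpace X] (hX : IsCAT0 X) {x p y : X} (hp : MetricBtw x p y)
    (z : X) :
    dist x y * dist z p ^ 2 ≤
      dist p y * dist z x ^ 2 + dist x p * dist z y ^ 2 - dist x p * dist p y * dist x y := by
  let f : X → ℝ := fun p => dist x y * dist z p ^ 2 - dist p y * dist z x ^ 2
    - dist x p * dist z y ^ 2 + dist x p * dist p y * dist x y
  suffices f p ≤ 0 by simp only [f] at this; linarith
  obtain ⟨q, hq, hmax⟩ := (isCompact_btw x y).exists_isMaxOn ⟨p, hp⟩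
    (f := f) (by fun_prop)
  refine (hmax hp).trans ?_
  have hq' : dist x q + dist q y = dist x y := hq
  rcases le_total (dist x q) (dist q y) with h | h
  · obtain ⟨w, hw, hqw⟩ := exists_btw_dist_eq hX q y dist_nonneg h
    have hxw := hq.left_of_right hw
    have hfw : f w ≤ f q := hmax (MetricBtw.trans_right hq hw)
    unfold MetricBtw at hw hxw
    have hcn := hX.cn (x := x) (y := w) (m := q) (by linarith)
      (by rw [dist_comm]; linarith) z
    have e₁ : dist x w = 2 * dist x q := by linarith
    have e₂ : dist w y = dist q y - dist x q := by linarith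
    simp only [f] at hfw ⊢
    rw [e₁] at hcn
    rw [e₁, e₂] at hfw
    have := mul_le_mul_of_nonneg_left hcn (dist_nonneg (x := x) (y := y))
    rw [← hq'] at *
    linarith
  · obtain ⟨w, hw, hqw⟩ := exists_btw_dist_eq hX q x (r := dist q y) dist_nonneg
      (by rwa [dist_comm q x])
    have hyw := hq.symm.left_of_right hw
    have hfw : f w ≤ f q := hmax (MetricBtw.trans_right hq.symm hw).symm
    unfold MetricBtw at hw hyw
    rw [dist_comm w x, dist_comm q x] at hw
    rw [dist_comm y q, dist_comm y w] at hyw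
    have hcn := hX.cn (x := w) (y := y) (m := q) (by rw [dist_comm]; linarith)
      (by rw [dist_comm]; linarith) z
    have e₁ : dist w y = 2 * dist q y := by linarith
    have e₂ : dist x w = dist x q - dist q y := by linarith
    simp only [f] at hfw ⊢
    rw [e₁] at hcn
    rw [e₁, e₂] at hfw
    have := mul_le_mul_of_nonneg_left hcn (dist_nonneg (x := x) (y := y))
    rw [← hq'] at *
    linarith

theorem IsCAT0.stewart_ratio [ProperSpace X] (hX : IsCAT0 X) {x p y : X} {l : ℝ}
    (h₁ : dist x p = l * dist x y) (h₂ : dist p y = (1 - l) * dist x y) (z : X) :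
    dist z p ^ 2 ≤
      (1 - l) * dist z x ^ 2 + l * dist z y ^ 2 - l * (1 - l) * dist x y ^ 2 := by
  rcases eq_or_lt_of_le (dist_nonneg : 0 ≤ dist x y) with h0 | h0
  · rw [← h0, mul_zero, dist_eq_zero] at h₁
    rw [← h₁, dist_eq_zero.1 h0.symm, dist_self]
    linarith
  · have := hX.stewart (MetricBtw.of_dist h₁ h₂) z
    rw [h₁, h₂] at this
    refine le_of_mul_le_mul_left ?_ h0
    linarith

/-- Points at the same ratio on two geodesics with a common origin. -/
theorem IsCAT0.dist_le_of_common [ProperSpace X] (hX : IsCAT0 X) {x y y' p q : X} {l : ℝ}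
    (h0 : 0 ≤ l) (h₁ : dist x p = l * dist x y) (h₂ : dist p y = (1 - l) * dist x y)
    (h₁' : dist x q = l * dist x y') (h₂' : dist q y' = (1 - l) * dist x y') :
    dist p q ≤ l * dist y y' := by
  have s₁ := hX.stewart_ratio h₁ h₂ q
  have s₂ := hX.stewart_ratio h₁' h₂' y
  rw [dist_comm q x, h₁', dist_comm q p, dist_comm q y] at s₁
  rw [dist_comm y x] at s₂
  refine abs_le_of_sq_le_sq' ?_ (by positivity) |>.2
  nlinarith [mul_le_mul_of_nonneg_left s₂ h0]

/-- Points at the same ratio on two geodesics. -/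
theorem IsCAT0.dist_le_ratio [ProperSpace X] (hX : IsCAT0 X) {x y x' y' p q : X} {l : ℝ}
    (h0 : 0 ≤ l) (h1 : l ≤ 1) (h₁ : dist x p = l * dist x y)
    (h₂ : dist p y = (1 - l) * dist x y)
    (h₁' : dist x' q = l * dist x' y') (h₂' : dist q y' = (1 - l) * dist x' y') :
    dist p q ≤ (1 - l) * dist x x' + l * dist y y' := by
  obtain ⟨m, hm₁, hm₂⟩ := exists_ratio_btw hX x y' h0 h1
  have a₁ := hX.dist_le_of_common h0 h₁ h₂ hm₁ hm₂
  have a₂ := hX.dist_le_of_common (x := y') (y := x) (y' := x') (p := m) (q := q) (l := 1 - l)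
    (by linarith) (by rw [dist_comm, hm₂, dist_comm x]) (by rw [dist_comm, hm₁, dist_comm x]; ring)
    (by rw [dist_comm, h₂', dist_comm x']) (by rw [dist_comm, h₁', dist_comm x']; ring)
  linarith [dist_triangle p m q]

theorem IsCAT0.btw_unique [ProperSpace X] (hX : IsCAT0 X) {x p q y : X} (hp : MetricBtw x p y)
    (hq : MetricBtw x q y) (h : dist x p = dist x q) : p = q := by
  obtain ⟨l, h0, -, h₁, h₂⟩ := hp.exists_ratio
  have := hX.dist_le_of_common h0 h₁ h₂ (h ▸ h₁)
    (by unfold MetricBtw at hp hq; linarith)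
  rw [dist_self, mul_zero] at this
  exact dist_le_zero.1 this

theorem IsCAT0.btw_of_dist_le [ProperSpace X] (hX : IsCAT0 X) {x p q y : X}
    (hp : MetricBtw x p y) (hq : MetricBtw x q y) (h : dist x p ≤ dist x q) :
    MetricBtw x p q := by
  obtain ⟨r, hr, hrx⟩ := exists_btw_dist_eq hX x q dist_nonneg h
  rwa [← hX.btw_unique (hq.trans_left hr) hp hrx]

theorem IsCAT0.dist_eq_abs [ProperSpace X] (hX : IsCAT0 X) {x p q y : X}
    (hp : MetricBtw x p y) (hq : MetricBtw x q y) : dist p q = |dist x p - dist x q| := by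
  rcases le_total (dist x p) (dist x q) with h | h
  · have := hX.btw_of_dist_le hp hq h
    unfold MetricBtw at this
    rw [abs_of_nonpos (by linarith)]
    linarith
  · have := hX.btw_of_dist_le hq hp h
    unfold MetricBtw at this
    rw [abs_of_nonneg (by linarith), dist_comm]
    linarith

theorem IsCAT0.exists_seg [ProperSpace X] (hX : IsCAT0 X) (x y : X) :
    ∃ c : ℝ → X, IsGeodesicSeg c x y ∧
      ∀ t ∈ Icc 0 (dist x y), MetricBtw x (c t) y ∧ dist x (c t) = t := by
  have : ∀ t : ℝ, ∃ p, t ∈ Icc 0 (dist x y) → MetricBtw x p y ∧ dist x p = t := by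
    intro t
    by_cases ht : t ∈ Icc 0 (dist x y)
    · obtain ⟨p, hp⟩ := exists_btw_dist_eq hX x y ht.1 ht.2
      exact ⟨p, fun _ => hp⟩
    · exact ⟨x, fun h => absurd h ht⟩
  choose c hc using this
  refine ⟨c, ⟨?_, ?_, ?_⟩, hc⟩
  · exact (dist_eq_zero.1 (hc 0 ⟨le_rfl, dist_nonneg⟩).2).symm
  · obtain ⟨h, h'⟩ := hc _ ⟨dist_nonneg, le_rfl⟩
    unfold MetricBtw at h
    exact dist_eq_zero.1 (by linarith)
  · intro s t hs ht
    rw [hX.dist_eq_abs (hc s hs).1 (hc t ht).1, (hc s hs).2, (hc t ht).2]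

/-- A point of a geodesic ending at `e` is followed by every geodesic ending at `e`. -/
theorem IsCAT0.exists_btw_near [ProperSpace X] (hX : IsCAT0 X) {q r e : X} (p : X)
    (hr : MetricBtw q r e) : ∃ p', MetricBtw p p' e ∧ dist p' r ≤ dist p q := by
  obtain ⟨l, h0, h1, h₁, h₂⟩ := hr.exists_ratio
  obtain ⟨p', hp₁, hp₂⟩ := exists_ratio_btw hX p e h0 h1
  refine ⟨p', .of_dist hp₁ hp₂, ?_⟩
  have := hX.dist_le_ratio h0 h1 hp₁ hp₂ h₁ h₂
  rw [dist_self, mul_zero, add_zero] at this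
  exact this.trans (mul_le_of_le_one_left dist_nonneg (by linarith))

/-- Geodesics overlapping in a nontrivial segment concatenate to a geodesic. -/
theorem IsCAT0.btw_concat [ProperSpace X] (hX : IsCAT0 X) {x p q y : X}
    (h₁ : MetricBtw x p q) (h₂ : MetricBtw p q y) (hpq : p ≠ q) : MetricBtw x q y := by
  obtain ⟨l, h0, h1, hl₁, hl₂⟩ := h₁.symm.exists_ratio
  have hl : 0 < l := by
    rcases h0.eq_or_lt with h | h
    · rw [← h, zero_mul, dist_eq_zero] at hl₁
      exact absurd hl₁.symm hpq
    · exact h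
  obtain ⟨w, hw₁, hw₂⟩ := exists_ratio_btw hX q y h0 h1
  have := hX.dist_le_of_common h0 hl₁ hl₂ hw₁ hw₂
  have hpwd : dist p w = dist p q + dist q w := by
    have a := MetricBtw.of_dist hw₁ hw₂
    unfold MetricBtw at a h₂
    linarith [dist_triangle p w y, dist_triangle p q w]
  unfold MetricBtw
  refine le_antisymm ?_ (dist_triangle x q y)
  refine le_of_mul_le_mul_left ?_ hl
  rw [hpwd, dist_comm p q, hl₁, hw₁, dist_comm q x] at this
  linarith

theorem IsRay.btw {c : ℝ → X} (hc : IsRay c) {s r t : ℝ} (hs : 0 ≤ s) (hsr : s ≤ r)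
    (hrt : r ≤ t) : MetricBtw (c s) (c r) (c t) := by
  unfold MetricBtw
  rw [hc s r hs (hs.trans hsr), hc r t (hs.trans hsr) (by linarith), hc s t hs (by linarith),
    abs_of_nonpos (by linarith), abs_of_nonpos (by linarith), abs_of_nonpos (by linarith)]
  ring

theorem IsRay.dist_zero {c : ℝ → X} (hc : IsRay c) {t : ℝ} (ht : 0 ≤ t) :
    dist (c 0) (c t) = t := by
  rw [hc 0 t le_rfl ht, zero_sub, abs_neg, abs_of_nonneg ht]

theorem IsGeodesicLine.isRay {c : ℝ → X} (hc : IsGeodesicLine c) : IsRay c :=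
  fun s t _ _ => hc s t

theorem IsGeodesicLine.btw {c : ℝ → X} (hc : IsGeodesicLine c) {s r t : ℝ}
    (hr : r ∈ uIcc s t) : MetricBtw (c s) (c r) (c t) := by
  unfold MetricBtw
  rw [hc, hc, hc]
  rcases mem_uIcc.1 hr with ⟨h₁, h₂⟩ | ⟨h₁, h₂⟩
  · rw [abs_of_nonpos (by linarith), abs_of_nonpos (by linarith), abs_of_nonpos (by linarith)]
    ring
  · rw [abs_of_nonneg (by linarith), abs_of_nonneg (by linarith), abs_of_nonneg (by linarith)]
    ring

theorem IsRay.eventually_le_dist {c : ℝ → X} (hc : IsRay c) (x : X) (T : ℝ) :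
    ∀ᶠ n : ℕ in atTop, T ≤ dist x (c n) := by
  filter_upwards [tendsto_natCast_atTop_atTop.eventually_ge_atTop (T + dist x (c 0))] with n hn
  have := hc.dist_zero (n.cast_nonneg)
  linarith [dist_triangle (c 0) x (c n), dist_comm x (c 0)]

/-- From every point there is a ray asymptotic to a given ray, and it is a limit of geodesics. -/
theorem IsCAT0.exists_ray [ProperSpace X] (hX : IsCAT0 X) (x : X) {c : ℝ → X}
    (hc : IsRay c) : ∃ k : ℝ → X, IsRay k ∧ k 0 = x ∧ Asymp k c ∧
      ∀ (u : ℝ) (y : X) (E : ℝ), 0 ≤ u → (∀ᶠ n : ℕ in atTop, ∀ p,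
        MetricBtw x p (c n) → dist x p = u → dist p y ≤ E) → dist (k u) y ≤ E := by
  choose s hs hs' using fun n : ℕ => hX.exists_seg x (c n)
  have hle : (hyperfilter ℕ : Filter ℕ) ≤ atTop := by
    rw [← Nat.cofinite_eq_atTop]
    exact hyperfilter_le_cofinite
  have hev : ∀ u : ℝ, 0 ≤ u → ∀ᶠ n in (hyperfilter ℕ : Filter ℕ),
      MetricBtw x (s n u) (c n) ∧ dist x (s n u) = u := fun u hu =>
    hle ((hc.eventually_le_dist x u).mono fun n hn => hs' n u ⟨hu, hn⟩)
  have hlim : ∀ u : ℝ, ∃ p, 0 ≤ u → Tendsto (fun n => s n u) (hyperfilter ℕ) (nhds p) := by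
    intro u
    by_cases hu : 0 ≤ u
    · obtain ⟨p, -, hp⟩ := (isCompact_closedBall x u).ultrafilter_le_nhds
        ((hyperfilter ℕ).map fun n => s n u) (by
          rw [le_principal_iff]
          exact (hev u hu).mono fun n hn => by
            rw [mem_closedBall, dist_comm]; exact hn.2.le)
      exact ⟨p, fun _ => hp⟩
    · exact ⟨x, fun h => absurd h hu⟩
  choose k hk using hlim
  have hclosed : ∀ (u : ℝ) (y : X) (E : ℝ), 0 ≤ u → (∀ᶠ n : ℕ in atTop, ∀ p,
        MetricBtw x p (c n) → dist x p = u → dist p y ≤ E) → dist (k u) y ≤ E := by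
    intro u y E hu h
    refine le_of_tendsto ((hk u hu).dist tendsto_const_nhds) ?_
    filter_upwards [hev u hu, hle h] with n h₁ h₂
    exact h₂ _ h₁.1 h₁.2
  refine ⟨k, ?_, ?_, ⟨2 * dist x (c 0), ?_⟩, hclosed⟩
  · intro u v hu hv
    refine tendsto_nhds_unique ((hk u hu).dist (hk v hv)) (tendsto_const_nhds.congr' ?_)
    filter_upwards [hev u hu, hev v hv] with n h₁ h₂
    rw [hX.dist_eq_abs h₁.1 h₂.1, h₁.2, h₂.2]
  · refine dist_le_zero.1 (hclosed 0 x 0 le_rfl (Eventually.of_forall fun n p _ h => ?_))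
    rw [dist_comm, h]
  · intro u hu
    refine hclosed u _ _ hu ?_
    filter_upwards [tendsto_natCast_atTop_atTop.eventually_ge_atTop u] with n hn p hp hpu
    obtain ⟨l, h0, h1, h₁, h₂⟩ := hp.exists_ratio
    have hln : 0 ≤ l * n := by positivity
    have hln' : l * n ≤ n := mul_le_of_le_one_left n.cast_nonneg h1
    have hd : dist (c 0) (c n) = n := hc.dist_zero n.cast_nonneg
    have key := hX.dist_le_ratio h0 h1 h₁ h₂ (x' := c 0) (y' := c n) (q := c (l * n))
      (by rw [hc.dist_zero hln, hd])
      (by rw [hc _ _ hln n.cast_nonneg, hd, abs_of_nonpos (by linarith)]; ring)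
    rw [dist_self, mul_zero, add_zero] at key
    have h3 : dist (c (l * n)) (c u) = l * |n - dist x (c n)| := by
      rw [hc _ _ hln hu, ← hpu, h₁, ← mul_sub, abs_mul, abs_of_nonneg h0]
    have h4 : |n - dist x (c n)| ≤ dist x (c 0) := by
      have := abs_dist_sub_le (c 0) x (c n)
      rwa [hd, dist_comm (c 0) x] at this
    have h5 := mul_le_mul_of_nonneg_left h4 h0
    have h6 : 0 ≤ dist x (c 0) := dist_nonneg
    have h7 : l * dist x (c 0) ≤ 1 * dist x (c 0) := mul_le_mul_of_nonneg_right h1 h6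
    have h8 : 0 ≤ l * dist x (c 0) := by positivity
    linarith [dist_triangle p (c (l * n)) (c u)]

/-- Geodesics that pass near `b T` are close to `b` before time `T`. -/
theorem IsCAT0.eventually_dist_le [ProperSpace X] (hX : IsCAT0 X) {b c : ℝ → X}
    (hb : IsRay b) (hc : IsRay c) {i T η : ℝ} (hT : 0 < T) (hi : 0 ≤ i) (hiT : i ≤ T)
    (h : ∀ᶠ n : ℕ in atTop, ∃ p, MetricBtw (b 0) p (c n) ∧ dist p (b T) ≤ η) :
    ∀ᶠ n : ℕ in atTop, ∀ p, MetricBtw (b 0) p (c n) → dist (b 0) p = i →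
      dist p (b i) ≤ i / T * (2 * η) := by
  filter_upwards [h, hc.eventually_le_dist (b 0) T] with n ⟨q, hq, hqη⟩ hTn p hp hpi
  obtain ⟨v, hv, hvT⟩ := exists_btw_dist_eq hX (b 0) (c n) hT.le hTn
  have hbT := hb.dist_zero hT.le
  have hvq : dist v q ≤ η := by
    rw [hX.dist_eq_abs hv hq, hvT, abs_le]
    constructor <;>
      linarith [dist_triangle (b 0) q (b T), dist_triangle (b 0) (b T) q, dist_comm q (b T)]
  have hpv := hX.btw_of_dist_le hp hv (by linarith)
  unfold MetricBtw at hpv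
  have key := hX.dist_le_of_common (x := b 0) (y := v) (y' := b T) (p := p) (q := b i)
    (l := i / T) (by positivity) (by rw [hvT, hpi]; field_simp)
    (by rw [hvT]; field_simp; linarith)
    (by rw [hbT, hb.dist_zero hi]; field_simp)
    (by rw [hbT, hb i T hi hT.le, abs_of_nonpos (by linarith)]; field_simp; ring)
  refine key.trans (mul_le_mul_of_nonneg_left ?_ (by positivity))
  linarith [dist_triangle v q (b T)]

/-- Geodesics from `y` to `c t` stay near the stretch of the line `c` between the projection
`c s` of `y` and `c t`. -/
theorem IsCAT0.exists_btw_near_line [ProperSpace X] (hX : IsCAT0 X) {c : ℝ → X}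
    (hc : IsGeodesicLine c) {y : X} {δ s r t : ℝ}
    (h : ∃ p, MetricBtw y p (c t) ∧ dist (c s) p ≤ δ) (hr : r ∈ uIcc s t) :
    ∃ p, MetricBtw y p (c t) ∧ dist p (c r) ≤ δ := by
  obtain ⟨p, hp, hpδ⟩ := h
  obtain ⟨p', hp', hd⟩ := hX.exists_btw_near p (hc.btw hr)
  exact ⟨p', hp.trans_right hp', hd.trans (by rwa [dist_comm])⟩

/-- If the ray of a slim line does not end where the line `a` does, its projections to `a` are
bounded above. -/
theorem IsCAT0.exists_bound_proj [ProperSpace X] (hX : IsCAT0 X) {a c : ℝ → X}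
    (ha : IsGeodesicLine a) (hc : IsGeodesicLine c) (S : X → ℝ) {δ : ℝ}
    (hS : ∀ y t, ∃ p, MetricBtw y p (a t) ∧ dist (a (S y)) p ≤ δ) (hca : ¬ Asymp c a) :
    ∃ L : ℝ, 0 ≤ L ∧ ∀ t, 0 ≤ t → S (c t) ≤ L := by
  by_contra! hcon
  refine hca ⟨2 * δ + 3 * dist (a 0) (c 0), fun u hu => ?_⟩
  obtain ⟨t, ht, hlt⟩ := hcon u hu
  set l := S (c t)
  obtain ⟨p, hp, hpδ⟩ := hS (c t) 0
  obtain ⟨l', h0', h1', h₁', h₂'⟩ := hp.symm.exists_ratio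
  obtain ⟨q, hq₁, hq₂⟩ := exists_ratio_btw hX (c 0) (c t) h0' h1'
  have hpq := hX.dist_le_ratio h0' h1' h₁' h₂' hq₁ hq₂
  rw [dist_self, mul_zero, add_zero] at hpq
  have hpq' : dist p q ≤ dist (a 0) (c 0) :=
    hpq.trans (mul_le_of_le_one_left dist_nonneg (by linarith))
  have hqt : dist (c 0) q ≤ t := by
    rw [hq₁, hc.isRay.dist_zero ht]
    exact mul_le_of_le_one_left ht h1'
  have hcq : c (dist (c 0) q) = q :=
    hX.btw_unique (hc.isRay.btw le_rfl dist_nonneg hqt) (.of_dist hq₁ hq₂)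
      (hc.isRay.dist_zero dist_nonneg)
  have hl : 0 < l := hu.trans_lt hlt
  have hal := ha.isRay.dist_zero hl.le
  have hqal : dist q (a l) ≤ δ + dist (a 0) (c 0) := by
    linarith [dist_triangle q p (a l), dist_comm p q, dist_comm p (a l)]
  have hqcl : dist q (c l) ≤ δ + 2 * dist (a 0) (c 0) := by
    rw [← hcq, hc, abs_le]
    constructor <;>
    linarith [dist_triangle4 (a 0) (c 0) q (a l), dist_triangle4 (c 0) (a 0) (a l) q,
      dist_comm (a 0) (c 0), dist_comm q (a l)]
  have hend : dist (c l) (a l) ≤ 2 * δ + 3 * dist (a 0) (c 0) := by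
    linarith [dist_triangle (c l) q (a l), dist_comm q (c l)]
  have hδ : 0 ≤ δ := dist_nonneg.trans hpδ
  have ratio : ∀ {f : ℝ → X}, IsGeodesicLine f →
      dist (f 0) (f u) = u / l * dist (f 0) (f l) ∧
      dist (f u) (f l) = (1 - u / l) * dist (f 0) (f l) := by
    intro f hf
    rw [hf.isRay.dist_zero hu, hf.isRay.dist_zero hl.le, hf, abs_of_nonpos (by linarith)]
    constructor <;> field_simp
    ring
  have hul : u / l ≤ 1 := (div_le_one hl).2 hlt.le
  have hul0 : 0 ≤ u / l := by positivity
  have key := hX.dist_le_ratio hul0 hul (ratio hc).1 (ratio hc).2 (ratio ha).1 (ratio ha).2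
  have h0 : dist (c 0) (a 0) ≤ 2 * δ + 3 * dist (a 0) (c 0) := by
    linarith [dist_comm (c 0) (a 0), dist_nonneg (x := c 0) (y := a 0)]
  have b₁ := mul_le_mul_of_nonneg_left h0 (sub_nonneg.2 hul)
  have b₂ := mul_le_mul_of_nonneg_left hend hul0
  linarith

/-- The geodesics from `b 0` to the points `c n` are eventually `E`-close to `b` at time `i`. -/
def EventuallyNear (b c : ℝ → X) (i E : ℝ) : Prop :=
  ∀ᶠ n : ℕ in atTop, ∀ p, MetricBtw (b 0) p (c n) → dist (b 0) p = i → dist p (b i) ≤ E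

/-- If `b 0` projects backward on a slim line starting near `b T`, the ray of the line
follows `b`. -/
theorem IsCAT0.eventuallyNear_of_proj_nonpos [ProperSpace X] (hX : IsCAT0 X) {b c : ℝ → X}
    (hb : IsRay b) (hc : IsGeodesicLine c) {δ C i T s : ℝ} (hi : 0 ≤ i) (hT : 0 < T)
    (hiT : i ≤ T) (hS : ∀ t, ∃ p, MetricBtw (b 0) p (c t) ∧ dist (c s) p ≤ δ)
    (hcb : dist (c 0) (b T) ≤ C) (hs : s ≤ 0) : EventuallyNear b c i (2 * (δ + C)) := by
  have hδ : 0 ≤ δ := by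
    obtain ⟨p, -, hp⟩ := hS 0
    exact dist_nonneg.trans hp
  have hC : 0 ≤ C := dist_nonneg.trans hcb
  refine (hX.eventually_dist_le hb hc.isRay (i := i) (η := δ + C) hT hi hiT
    (Eventually.of_forall fun n => ?_)).mono fun n h p hp hpi => (h p hp hpi).trans ?_
  · obtain ⟨p, hp, hpd⟩ := hX.exists_btw_near_line hc (hS n)
      (mem_uIcc.2 (Or.inl ⟨hs, n.cast_nonneg⟩))
    exact ⟨p, hp, by linarith [dist_triangle p (c 0) (b T)]⟩
  · exact mul_le_of_le_one_left (by linarith) ((div_le_one hT).2 hiT)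

/-- The projection of `b 0` on a slim line starting near `b T` is near some `b u`. -/
theorem IsCAT0.exists_near_proj [ProperSpace X] (hX : IsCAT0 X) {b c : ℝ → X}
    (hb : IsRay b) {δ C T s : ℝ} (hT : 0 ≤ T)
    (hS : ∀ t, ∃ p, MetricBtw (b 0) p (c t) ∧ dist (c s) p ≤ δ)
    (hcb : dist (c 0) (b T) ≤ C) : ∃ u, 0 ≤ u ∧ u ≤ T ∧ dist (c s) (b u) ≤ δ + C := by
  obtain ⟨p, hp, hpd⟩ := hS 0
  obtain ⟨l, h0, h1, h₁, h₂⟩ := hp.exists_ratio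
  have hlT : 0 ≤ l * T := by positivity
  have hlT' : l * T ≤ T := mul_le_of_le_one_left hT h1
  have hbT := hb.dist_zero hT
  have := hX.dist_le_of_common h0 h₁ h₂ (y' := b T) (q := b (l * T))
    (by rw [hb.dist_zero hlT, hbT])
    (by rw [hb _ _ hlT hT, hbT, abs_of_nonpos (by linarith)]; ring)
  refine ⟨l * T, hlT, hlT', ?_⟩
  have h3 : l * dist (c 0) (b T) ≤ dist (c 0) (b T) := mul_le_of_le_one_left dist_nonneg h1
  linarith [dist_triangle (c s) p (b (l * T))]

/-- If `e` projects to a slim line `c` not far beyond its base point, then geodesics to `e` from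
points close to a later point of `c` pass near the base point. -/
theorem IsCAT0.exists_btw_near_of_proj_le [ProperSpace X] (hX : IsCAT0 X) {x e : X}
    {c : ℝ → X} (hc : IsGeodesicLine c) {δ s l L : ℝ}
    (hS : ∀ t, ∃ p, MetricBtw e p (c t) ∧ dist (c l) p ≤ δ) (hL : 0 ≤ L) (hl : l ≤ L)
    (hs : L ≤ s) : ∃ p, MetricBtw x p e ∧ dist p (c 0) ≤ dist x (c s) + δ + L := by
  obtain ⟨p, hp, hpd⟩ := hX.exists_btw_near_line hc (hS s) (mem_uIcc.2 (Or.inl ⟨hl, hs⟩))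
  obtain ⟨q, hq, hqd⟩ := hX.exists_btw_near x hp.symm
  have := hc.isRay.dist_zero hL
  exact ⟨q, hq, by linarith [dist_triangle4 q p (c L) (c 0), dist_comm (c 0) (c L)]⟩

/-- The version of `IsCAT0.exists_btw_near_of_proj_le` for lines that are `0`-slim: the geodesic
contains a late point of `b`. -/
theorem IsCAT0.btw_of_proj_lt [ProperSpace X] (hX : IsCAT0 X) {b c : ℝ → X} {e : X}
    (hb : IsRay b) (hc : IsGeodesicLine c) {T s l L : ℝ} (hT : 0 ≤ T)
    (hSx : ∀ t, ∃ p, MetricBtw (b 0) p (c t) ∧ dist (c s) p ≤ 0)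
    (hSe : ∀ t, ∃ p, MetricBtw e p (c t) ∧ dist (c l) p ≤ 0) (hcb : c 0 = b T)
    (hL : 0 ≤ L) (hl : l ≤ L) (hs : L < s) (hLT : L ≤ T) :
    ∃ r, 0 ≤ r ∧ r ≤ L ∧ MetricBtw (b 0) (b (T - r)) e := by
  have hx : ∀ t, MetricBtw (b 0) (c s) (c t) := fun t => by
    obtain ⟨p, hp, h⟩ := hSx t
    rwa [dist_le_zero.1 h]
  have he : ∀ t, MetricBtw e (c l) (c t) := fun t => by
    obtain ⟨p, hp, h⟩ := hSe t
    rwa [dist_le_zero.1 h]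
  have hne : c s ≠ c l := by
    rw [← dist_pos, hc]
    exact abs_pos.2 (by linarith)
  have hle : MetricBtw (b 0) (c l) e := hX.btw_concat (hx l) (he s).symm hne
  have hr0 : 0 ≤ max l 0 := le_max_right _ _
  have hrL : max l 0 ≤ L := max_le hl hL
  have hrl : MetricBtw (b 0) (c (max l 0)) (c l) :=
    (hx l).trans_right (hc.btw (mem_uIcc.2 (Or.inr ⟨le_max_left _ _, by linarith⟩)))
  have hr : MetricBtw (b 0) (c (max l 0)) (b T) := by
    rw [← hcb]
    exact (hx 0).trans_right (hc.btw (mem_uIcc.2 (Or.inr ⟨hr0, by linarith⟩)))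
  have heq : b (T - max l 0) = c (max l 0) := by
    refine hX.btw_unique (hb.btw le_rfl (by linarith) (by linarith)) hr ?_
    have h₁ : dist (c (max l 0)) (b T) = max l 0 := by
      rw [← hcb, dist_comm, hc.isRay.dist_zero hr0]
    unfold MetricBtw at hr
    rw [hb.dist_zero hT] at hr
    rw [hb.dist_zero (by linarith)]
    linarith
  exact ⟨max l 0, hr0, hrL, by rw [heq]; exact hle.trans_left hrl⟩

/-- Of two rays, one on a slim line `c` starting near `b T` and one with projections to `c`
bounded above, one follows `b`, provided `T` is large. -/
theorem IsCAT0.eventuallyNear_or [ProperSpace X] (hX : IsCAT0 X) {b c c' : ℝ → X}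
    (hb : IsRay b) (hc : IsGeodesicLine c) (hc' : IsRay c') (S : X → ℝ) {δ C i T L η : ℝ}
    (hS : ∀ y t, ∃ p, MetricBtw y p (c t) ∧ dist (c (S y)) p ≤ δ) (hi : 0 ≤ i)
    (hL : 0 ≤ L) (hc'L : ∀ t, 0 ≤ t → S (c' t) ≤ L) (hcb : dist (c 0) (b T) ≤ C)
    (hη : 2 * i + 2 + 2 * (δ + C) + L ≤ η) (hT : η + i + i * η / (δ + C) ≤ T) :
    EventuallyNear b c i (2 * (δ + C)) ∨ EventuallyNear b c' i (2 * (δ + C)) := by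
  have hδ : 0 ≤ δ := by
    obtain ⟨p, -, hp⟩ := hS (b 0) 0
    exact dist_nonneg.trans hp
  have hC : 0 ≤ C := dist_nonneg.trans hcb
  have hη0 : 0 < η := by linarith
  have hdiv : 0 ≤ i * η / (δ + C) := by positivity
  have hT0 : 0 < T := by linarith
  rcases le_or_gt (S (b 0)) 0 with hs | hs
  · exact Or.inl (hX.eventuallyNear_of_proj_nonpos hb hc hi hT0 (by linarith) (hS (b 0)) hcb hs)
  obtain ⟨u, hu0, huT, hu⟩ := hX.exists_near_proj hb hT0.le (hS (b 0)) hcb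
  rcases le_or_gt (2 * i + 1) u with hiu | hiu
  · left
    have hu0' : 0 < u := by linarith
    refine (hX.eventually_dist_le hb hc.isRay (i := i) (η := 2 * δ + C) hu0' hi (by linarith)
      ?_).mono fun n h p hp hpi => (h p hp hpi).trans ?_
    · filter_upwards [tendsto_natCast_atTop_atTop.eventually_ge_atTop (S (b 0))] with n hn
      obtain ⟨p, hp, hpd⟩ := hS (b 0) n
      exact ⟨p, hp, by linarith [dist_triangle p (c (S (b 0))) (b u), dist_comm p (c (S (b 0)))]⟩
    · have h2 : i / u ≤ 1 / 2 := by
        rw [div_le_div_iff₀ hu0' two_pos]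
        linarith
      have := mul_le_mul_of_nonneg_right h2 (show 0 ≤ 2 * (2 * δ + C) by linarith)
      linarith
  right
  have hxs : dist (b 0) (c (S (b 0))) ≤ 2 * i + 1 + δ + C := by
    have := hb.dist_zero hu0
    linarith [dist_triangle (b 0) (b u) (c (S (b 0))), dist_comm (b u) (c (S (b 0)))]
  have hLs : L < S (b 0) := by
    have h₁ := hc.isRay.dist_zero hs.le
    have h₂ := hb.dist_zero hT0.le
    linarith [dist_triangle4 (b 0) (c (S (b 0))) (c 0) (b T), dist_comm (c 0) (c (S (b 0)))]
  rcases (add_nonneg hδ hC).eq_or_lt with h0 | h0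
  · have hδ0 : δ = 0 := by linarith
    have hC0 : C = 0 := by linarith
    subst hδ0 hC0
    have hcT : c 0 = b T := dist_le_zero.1 hcb
    filter_upwards [hc'.eventually_le_dist (b 0) i] with n hn p hp hpi
    obtain ⟨r, hr0, hrL, hr⟩ := hX.btw_of_proj_lt hb hc hT0.le (hS (b 0)) (hS (c' n)) hcT hL
      (hc'L n n.cast_nonneg) hLs (by linarith)
    have hbi := hr.trans_left (hb.btw le_rfl hi (by linarith : i ≤ T - r))
    rw [hX.btw_unique hp hbi (by rw [hpi, hb.dist_zero hi])]
    simp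
  · refine (hX.eventually_dist_le hb hc' (i := i) (η := η) hT0 hi (by linarith)
      (Eventually.of_forall fun n => ?_)).mono fun n h p hp hpi => (h p hp hpi).trans ?_
    · obtain ⟨p, hp, hpd⟩ := hX.exists_btw_near_of_proj_le (x := b 0) hc (hS (c' n)) hL
        (hc'L n n.cast_nonneg) hLs.le
      exact ⟨p, hp, by linarith [dist_triangle p (c 0) (b T)]⟩
    · have h₁ : i * η ≤ T * (δ + C) := (div_le_iff₀ h0).1 (by linarith)
      rw [div_mul_eq_mul_div, div_le_iff₀ hT0]
      linarith

theorem orbit_rays_converge [ProperSpace X] (hX : IsCAT0 X)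
    (G : Type*) [Group G] [MulAction G X]
    (hiso : ∀ g : G, Isometry fun p : X => g • p)
    (x : X) (C : ℝ) (hC : 0 ≤ C) (hcc : ∀ p : X, ∃ g : G, dist p (g • x) ≤ C)
    (a : ℝ → X) (ha : IsGeodesicLine a) (ha0 : a 0 = x)
    (A δA : ℝ) (π : X → X) (hproj : IsProjOn (range a) π)
    (hcontr : ∀ p q : X, dist p q < dist p (π p) → dist (π p) (π q) < A)
    (hslim : SlimWith δA (range a) π)
    (hnotfix : ∃ g : G, ¬ Asymp (fun t => g • a t) a)
    (b : ℝ → X) (hb : IsRay b) (hb0 : b 0 = x) :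
    ∃ g : ℕ → G, ∃ k : ℕ → ℝ → X,
      (∀ i : ℕ, IsRay (k i) ∧ k i 0 = x ∧ Asymp (k i) (fun t => (g i) • a t)) ∧
      (∀ i : ℕ, dist (k i (i : ℝ)) (b (i : ℝ)) ≤ 2 * (δA + C)) ∧
      (∀ ρ : ℝ, 0 ≤ ρ →
        Tendsto (fun i : ℕ => dist (k i ρ) (b ρ)) atTop (nhds 0)) := by
  have hd : ∀ (g : G) (p q : X), dist (g • p) (g • q) = dist p q := fun g => (hiso g).dist_eq
  have hline : ∀ g : G, IsGeodesicLine fun t => g • a t := fun g s t => by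
    rw [hd, ha]
  choose S hSπ using fun y => (hproj y).1
  have hS : ∀ y t, ∃ p, MetricBtw y p (a t) ∧ dist (a (S y)) p ≤ δA := by
    intro y t
    obtain ⟨f, hf, hf'⟩ := hX.exists_seg y (a t)
    obtain ⟨s, hs, hle⟩ := hslim y (a t) ⟨t, rfl⟩ f hf
    exact ⟨f s, (hf' s hs).1, by rwa [hSπ]⟩
  have hSg : ∀ (g : G) (y : X) (t : ℝ),
      ∃ p, MetricBtw y p (g • a t) ∧ dist (g • a (S (g⁻¹ • y))) p ≤ δA := by
    intro g y t
    obtain ⟨p, hp, hle⟩ := hS (g⁻¹ • y) t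
    refine ⟨g • p, ?_, by rwa [hd]⟩
    unfold MetricBtw at hp ⊢
    rwa [← hd g, ← hd g p, ← hd g (g⁻¹ • y), smul_inv_smul] at hp
  obtain ⟨h, hh⟩ := hnotfix
  obtain ⟨L, hL, hLS⟩ := hX.exists_bound_proj ha (hline h) S hS hh
  have hδ : 0 ≤ δA := by
    obtain ⟨p, -, hp⟩ := hS x 0
    exact dist_nonneg.trans hp
  have hgood : ∀ i : ℕ, ∃ g : G, EventuallyNear b (fun t => g • a t) i (2 * (δA + C)) := by
    intro i
    set η : ℝ := 2 * i + 2 + 2 * (δA + C) + L with hη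
    obtain ⟨g, hg⟩ := hcc (b (η + i + i * η / (δA + C)))
    rcases hX.eventuallyNear_or hb (hline g) (hline (g * h)).isRay (fun y => S (g⁻¹ • y))
      (hSg g) i.cast_nonneg hL
      (fun t ht => by simpa only [mul_smul, inv_smul_smul] using hLS t ht)
      (by rwa [ha0, dist_comm]) hη.symm.le le_rfl with h' | h'
    exacts [⟨g, h'⟩, ⟨g * h, h'⟩]
  choose g hg using hgood
  choose k hk hk0 hka hkE using fun i => hX.exists_ray x (hline (g i)).isRay
  have hbound : ∀ i : ℕ, dist (k i i) (b i) ≤ 2 * (δA + C) := fun i =>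
    hkE i i (b i) _ i.cast_nonneg (by simpa only [EventuallyNear, hb0] using hg i)
  refine ⟨g, k, fun i => ⟨hk i, hk0 i, hka i⟩, hbound, fun ρ hρ => ?_⟩
  have hlim : Tendsto (fun i : ℕ => ρ * (2 * (δA + C)) / (i : ℝ)) atTop (nhds 0) :=
    tendsto_const_div_atTop_nhds_zero_nat _
  refine squeeze_zero' (Eventually.of_forall fun _ => dist_nonneg) ?_ hlim
  filter_upwards [tendsto_natCast_atTop_atTop.eventually_ge_atTop ρ, eventually_gt_atTop 0]
    with i hi hi0
  have hi0' : (0 : ℝ) < i := by exact_mod_cast hi0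
  have ratio : ∀ {f : ℝ → X}, IsRay f → f 0 = x →
      dist x (f ρ) = ρ / i * dist x (f i) ∧ dist (f ρ) (f i) = (1 - ρ / i) * dist x (f i) := by
    rintro f hf rfl
    rw [hf.dist_zero hρ, hf.dist_zero hi0'.le, hf ρ i hρ hi0'.le, abs_of_nonpos (by linarith)]
    constructor <;> field_simp
    ring
  refine (hX.dist_le_of_common (by positivity) (ratio (hk i) (hk0 i)).1
    (ratio (hk i) (hk0 i)).2 (ratio hb hb0).1 (ratio hb hb0).2).trans ?_
  rw [div_mul_eq_mul_div]
  have := hbound i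
  gcongr
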